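/- For integers r ≥ 1 and s ≥ 1, ζ(r̄, s̄) = -(1/(Γ(r)Γ(s))) ∫₀^∞ ∫₀^∞ t^{s-1} u^{r-1} / ((e^t + 1)(e^{t+u} - 1)) du dt. -/

import Mathlib

open Filter Finset Real

/-- `zeta k` : the Riemann zeta value `ζ(k) = Σ_{m≥1} 1/m^k`, with the convention `ζ(0) = -1/2`. -/
noncomputable def zeta (k : ℕ) : ℝ :=
  if k = 0 then -1/2 else limUnder atTop (fun N => ∑ m ∈ Finset.range N, 1/((m+1 : ℝ))^k)

/-- `zetaA k` : the alternating zeta value `ζ(k̄) = Σ_{m≥1} (-1)^m/m^k`,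
with the convention `ζ(0̄) = -1/2`. -/
noncomputable def zetaA (k : ℕ) : ℝ :=
  if k = 0 then -1/2 else
    limUnder atTop (fun N => ∑ m ∈ Finset.range N, (-1 : ℝ)^(m+1)/((m+1 : ℝ))^k)

/-- `dzeta r s = ζ(r,s) = Σ_{m≥2} (1/m^s) Σ_{j=1}^{m-1} 1/j^r`. -/
noncomputable def dzeta (r s : ℕ) : ℝ :=
  limUnder atTop (fun N => ∑ m ∈ Finset.range N,
    (1/((m+2 : ℝ))^s) * ∑ j ∈ Finset.range (m+1), 1/((j+1 : ℝ))^r)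

/-- `dzetaA1 r s = ζ(r̄,s) = Σ_{m≥2} (1/m^s) Σ_{j=1}^{m-1} (-1)^j/j^r`. -/
noncomputable def dzetaA1 (r s : ℕ) : ℝ :=
  limUnder atTop (fun N => ∑ m ∈ Finset.range N,
    (1/((m+2 : ℝ))^s) * ∑ j ∈ Finset.range (m+1), (-1 : ℝ)^(j+1)/((j+1 : ℝ))^r)

/-- `dzetaA2 r s = ζ(r,s̄) = Σ_{m≥2} ((-1)^m/m^s) Σ_{j=1}^{m-1} 1/j^r`. -/
noncomputable def dzetaA2 (r s : ℕ) : ℝ :=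
  limUnder atTop (fun N => ∑ m ∈ Finset.range N,
    ((-1 : ℝ)^(m+2)/((m+2 : ℝ))^s) * ∑ j ∈ Finset.range (m+1), 1/((j+1 : ℝ))^r)

/-- `dzetaA3 r s = ζ(r̄,s̄) = Σ_{m≥2} ((-1)^m/m^s) Σ_{j=1}^{m-1} (-1)^j/j^r`. -/
noncomputable def dzetaA3 (r s : ℕ) : ℝ :=
  limUnder atTop (fun N => ∑ m ∈ Finset.range N,
    ((-1 : ℝ)^(m+2)/((m+2 : ℝ))^s) * ∑ j ∈ Finset.range (m+1), (-1 : ℝ)^(j+1)/((j+1 : ℝ))^r)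

open MeasureTheory Topology

lemma sum_range_pow_add {z : ℝ} (hz : z ≠ 1) (a N : ℕ) :
    ∑ m ∈ Finset.range N, z ^ (m + a) = z ^ a * (1 - z ^ N) / (1 - z) := by
  simp_rw [pow_add, ← Finset.sum_mul]
  rw [geom_sum_eq hz, ← neg_div_neg_eq, neg_sub, neg_sub]
  ring

lemma sum_neg_geom_mul_sum_neg_geom {x y : ℝ} (hx : 1 + x ≠ 0) (hy : 1 + y ≠ 0)
    (hxy : 1 - x * y ≠ 0) (N : ℕ) :
    ∑ m ∈ Finset.range N, (-x) ^ (m + 2) * ∑ j ∈ Finset.range (m + 1), (-y) ^ (j + 1) =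
      -(y * x ^ 2 * (1 - (-x) ^ N) / (1 + x) +
        x ^ 2 * y ^ 2 * (1 - (x * y) ^ N) / (1 - x * y)) / (1 + y) := by
  have hx' : -x ≠ 1 := fun h => hx (by linarith)
  have hy' : -y ≠ 1 := fun h => hy (by linarith)
  have hxy' : x * y ≠ 1 := fun h => hxy (by linarith)
  have hterm (m : ℕ) : (-x) ^ (m + 2) * ∑ j ∈ Finset.range (m + 1), (-y) ^ (j + 1) =
      -(y * (-x) ^ (m + 2) + (x * y) ^ (m + 2)) / (1 + y) := by
    rw [sum_range_pow_add hy', ← neg_mul_neg x y, mul_pow, sub_neg_eq_add]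
    ring
  simp_rw [hterm]
  rw [← Finset.sum_div, Finset.sum_neg_distrib, Finset.sum_add_distrib, ← Finset.mul_sum,
    sum_range_pow_add hx', sum_range_pow_add hxy', sub_neg_eq_add]
  ring

lemma tendsto_sum_neg_geom_mul_sum_neg_geom {x y : ℝ} (hx₀ : 0 < x) (hx₁ : x < 1)
    (hy₀ : 0 < y) (hy₁ : y < 1) :
    Tendsto (fun N : ℕ => ∑ m ∈ Finset.range N,
        (-x) ^ (m + 2) * ∑ j ∈ Finset.range (m + 1), (-y) ^ (j + 1)) atTop
      (𝓝 (-(x ^ 2 * y / ((1 + x) * (1 - x * y))))) := by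
  have hxy : x * y < 1 := by nlinarith
  have h₁ : 1 + x ≠ 0 := by positivity
  have h₂ : 1 + y ≠ 0 := by positivity
  have h₃ : 1 - x * y ≠ 0 := by linarith
  simp_rw [sum_neg_geom_mul_sum_neg_geom h₁ h₂ h₃]
  have hx : Tendsto (fun N : ℕ => (-x) ^ N) atTop (𝓝 0) :=
    tendsto_pow_atTop_nhds_zero_of_abs_lt_one (by rwa [abs_neg, abs_of_pos hx₀])
  have hp : Tendsto (fun N : ℕ => (x * y) ^ N) atTop (𝓝 0) :=
    tendsto_pow_atTop_nhds_zero_of_lt_one (by positivity) hxy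
  have key := ((((hx.const_sub 1).const_mul (y * x ^ 2)).div_const (1 + x)).add
    (((hp.const_sub 1).const_mul (x ^ 2 * y ^ 2)).div_const (1 - x * y))).neg.div_const (1 + y)
  convert key using 2
  field_simp
  ring

lemma abs_sum_neg_geom_mul_sum_neg_geom_le {x y : ℝ} (hx₀ : 0 < x) (hx₁ : x < 1)
    (hy₀ : 0 < y) (hy₁ : y < 1) (N : ℕ) :
    |∑ m ∈ Finset.range N, (-x) ^ (m + 2) * ∑ j ∈ Finset.range (m + 1), (-y) ^ (j + 1)| ≤
      3 * (x * y / (1 - x * y)) := by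
  have hxy : x * y < 1 := by nlinarith
  have hp : 0 < 1 - x * y := by linarith
  have hx : |(-x) ^ N| ≤ 1 := by
    rw [abs_pow, abs_neg, abs_of_pos hx₀]; exact pow_le_one₀ hx₀.le hx₁.le
  have hpow₀ : 0 ≤ (x * y) ^ N := by positivity
  have hpow₁ : (x * y) ^ N ≤ 1 := pow_le_one₀ (by positivity) hxy.le
  obtain ⟨hx₂, hx₃⟩ := abs_le.1 hx
  rw [sum_neg_geom_mul_sum_neg_geom (by positivity) (by positivity) hp.ne']
  have hA₀ : 0 ≤ y * x ^ 2 * (1 - (-x) ^ N) / (1 + x) := by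
    have : 0 ≤ 1 - (-x) ^ N := by linarith
    positivity
  have hB₀ : 0 ≤ x ^ 2 * y ^ 2 * (1 - (x * y) ^ N) / (1 - x * y) := by
    have : 0 ≤ 1 - (x * y) ^ N := by linarith
    positivity
  have hA : y * x ^ 2 * (1 - (-x) ^ N) / (1 + x) ≤ 2 * (x * y / (1 - x * y)) := by
    calc y * x ^ 2 * (1 - (-x) ^ N) / (1 + x) ≤ y * x ^ 2 * (1 - (-x) ^ N) :=
          div_le_self (by have : 0 ≤ 1 - (-x) ^ N := by linarith
                          positivity) (by linarith)
      _ ≤ y * x ^ 2 * 2 := by gcongr; linarith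
      _ ≤ 2 * (x * y) := by nlinarith [mul_pos hx₀ hy₀]
      _ ≤ 2 * (x * y / (1 - x * y)) := by
          gcongr
          exact le_div_self (by positivity) hp (by nlinarith [mul_pos hx₀ hy₀])
  have hB : x ^ 2 * y ^ 2 * (1 - (x * y) ^ N) / (1 - x * y) ≤ x * y / (1 - x * y) := by
    refine div_le_div_of_nonneg_right ?_ hp.le
    have : 0 < x * y := by positivity
    calc x ^ 2 * y ^ 2 * (1 - (x * y) ^ N) ≤ x ^ 2 * y ^ 2 * 1 := by gcongr; linarith
      _ ≤ x * y := by nlinarith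
  rw [abs_div, abs_neg, abs_of_nonneg (by positivity), abs_of_pos (by positivity : 0 < 1 + y)]
  exact (div_le_self (by positivity) (by linarith)).trans (by linarith)

lemma integrableOn_pow_mul_exp_neg_pow (n : ℕ) {k : ℕ} (hk : 0 < k) :
    IntegrableOn (fun t : ℝ => t ^ n * exp (-t) ^ k) (Set.Ioi 0) := by
  have h := integrableOn_rpow_mul_exp_neg_mul_rpow (s := n) (p := 1) (b := k)
    (by have : (0 : ℝ) ≤ n := by positivity
        linarith) one_pos (by positivity)
  refine h.congr_fun (fun t _ => ?_) measurableSet_Ioi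
  simp only [rpow_natCast, rpow_one, ← exp_nat_mul]
  ring_nf

lemma integral_pow_mul_exp_neg_pow {s k : ℕ} (hs : 1 ≤ s) (hk : 0 < k) :
    ∫ t in Set.Ioi (0 : ℝ), t ^ (s - 1) * exp (-t) ^ k = Gamma s / (k : ℝ) ^ s := by
  have h := integral_rpow_mul_exp_neg_mul_Ioi (a := s) (r := k)
    (by positivity) (by positivity)
  rw [rpow_natCast, one_div, inv_pow, mul_comm, ← div_eq_mul_inv] at h
  rw [← h]
  refine setIntegral_congr_fun measurableSet_Ioi fun t _ => ?_
  simp only [← exp_nat_mul]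
  rw [← rpow_natCast t, Nat.cast_sub hs]
  simp

lemma integrableOn_pow_mul_rpow_mul_exp_neg (n : ℕ) :
    IntegrableOn (fun t : ℝ => t ^ n * exp (-t) * t ^ (-1 / 2 : ℝ)) (Set.Ioi 0) := by
  have h := integrableOn_rpow_mul_exp_neg_mul_rpow (s := n + (-1 / 2 : ℝ)) (p := 1)
    (b := 1) (by have : (0 : ℝ) ≤ n := by positivity
                 linarith) one_pos one_pos
  refine h.congr_fun (fun t ht => ?_) measurableSet_Ioi
  simp only [rpow_one, rpow_add (Set.mem_Ioi.1 ht), rpow_natCast]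
  ring_nf

lemma exp_neg_mul_exp_neg_div_le {t u : ℝ} (ht : 0 < t) (hu : 0 < u) :
    exp (-t) * exp (-u) / (1 - exp (-t) * exp (-u)) ≤
      exp (-t) * exp (-u) * (1 + t ^ (-1 / 2 : ℝ) * u ^ (-1 / 2 : ℝ)) := by
  rw [div_eq_mul_inv]
  gcongr
  rw [← exp_add]
  have hv : 0 < t + u := by positivity
  have h₁ : (1 - exp (-t + -u))⁻¹ ≤ 1 + (t + u)⁻¹ := by
    have hle := add_one_le_exp (t + u)
    have he : exp (-t + -u) = (exp (t + u))⁻¹ := by rw [← exp_neg]; ring_nf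
    have h : exp (-t + -u) ≤ (t + u + 1)⁻¹ := by rw [he]; gcongr
    calc (1 - exp (-t + -u))⁻¹ ≤ (1 - (t + u + 1)⁻¹)⁻¹ := by
          gcongr
          have : (t + u + 1)⁻¹ < 1 := inv_lt_one_of_one_lt₀ (by linarith)
          linarith
      _ = 1 + (t + u)⁻¹ := by
          have : 1 - (t + u + 1)⁻¹ = (t + u) / (t + u + 1) := by field_simp; ring
          rw [this]; field_simp
  have h₂ : (t + u)⁻¹ ≤ t ^ (-1 / 2 : ℝ) * u ^ (-1 / 2 : ℝ) := by
    rw [← mul_rpow ht.le hu.le, neg_div, rpow_neg (by positivity), ← sqrt_eq_rpow]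
    gcongr
    rw [sqrt_le_left (by positivity)]
    nlinarith [mul_pos ht hu]
  linarith

theorem tendsto_dzetaA3_partial_sums (r s : ℕ) (hr : 1 ≤ r) (hs : 1 ≤ s) :
    Tendsto (fun N => ∑ m ∈ Finset.range N, ((-1 : ℝ) ^ (m + 2) / ((m + 2 : ℝ)) ^ s) *
        ∑ j ∈ Finset.range (m + 1), (-1 : ℝ) ^ (j + 1) / ((j + 1 : ℝ)) ^ r) atTop
      (𝓝 (-(1 / (Gamma r * Gamma s)) * ∫ t in Set.Ioi (0 : ℝ), ∫ u in Set.Ioi (0 : ℝ),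
        t ^ (s - 1) * u ^ (r - 1) / ((exp t + 1) * (exp (t + u) - 1)))) := by
  set μ : Measure ℝ := volume.restrict (Set.Ioi 0) with hμ
  let F (N : ℕ) (p : ℝ × ℝ) : ℝ := p.1 ^ (s - 1) * p.2 ^ (r - 1) * ∑ m ∈ Finset.range N,
    (-exp (-p.1)) ^ (m + 2) * ∑ j ∈ Finset.range (m + 1), (-exp (-p.2)) ^ (j + 1)
  let G (p : ℝ × ℝ) : ℝ := p.1 ^ (s - 1) * p.2 ^ (r - 1) /
    ((exp p.1 + 1) * (exp (p.1 + p.2) - 1))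
  let B (p : ℝ × ℝ) : ℝ := 3 * (p.1 ^ (s - 1) * p.2 ^ (r - 1) *
    (exp (-p.1) * exp (-p.2) * (1 + p.1 ^ (-1 / 2 : ℝ) * p.2 ^ (-1 / 2 : ℝ))))
  have hpos : ∀ᵐ p ∂(μ.prod μ), 0 < p.1 ∧ 0 < p.2 := by
    rw [hμ, Measure.prod_restrict]
    filter_upwards [ae_restrict_mem (measurableSet_Ioi.prod measurableSet_Ioi)] with p hp
    exact hp
  have hB : Integrable B (μ.prod μ) := by
    have h₁ := (integrableOn_pow_mul_exp_neg_pow (s - 1) one_pos).integrable.mul_prod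
      (integrableOn_pow_mul_exp_neg_pow (r - 1) one_pos).integrable
    have h₂ := (integrableOn_pow_mul_rpow_mul_exp_neg (s - 1)).integrable.mul_prod
      (integrableOn_pow_mul_rpow_mul_exp_neg (r - 1)).integrable
    refine ((h₁.add h₂).const_mul 3).congr (.of_forall fun p => ?_)
    simp only [Pi.add_apply, pow_one, B]
    ring
  have hterm (k l : ℕ) := (integrableOn_pow_mul_exp_neg_pow (s - 1) k.succ_pos).integrable.mul_prod
      (integrableOn_pow_mul_exp_neg_pow (r - 1) l.succ_pos).integrable
  have hFeq (N : ℕ) : F N = fun p => ∑ m ∈ Finset.range N, ∑ j ∈ Finset.range (m + 1),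
      ((-1) ^ (m + 2) * (-1) ^ (j + 1)) * ((p.1 ^ (s - 1) * exp (-p.1) ^ (m + 1 + 1)) *
        (p.2 ^ (r - 1) * exp (-p.2) ^ (j + 1))) := by
    funext p
    simp only [F, Finset.mul_sum]
    refine Finset.sum_congr rfl fun m _ => Finset.sum_congr rfl fun j _ => ?_
    rw [neg_pow (exp (-p.1)), neg_pow (exp (-p.2))]
    ring
  have hFint (N : ℕ) : ∫ p, F N p ∂(μ.prod μ) = (Gamma r * Gamma s) *
      ∑ m ∈ Finset.range N, ((-1 : ℝ) ^ (m + 2) / ((m + 2 : ℝ)) ^ s) *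
        ∑ j ∈ Finset.range (m + 1), (-1 : ℝ) ^ (j + 1) / ((j + 1 : ℝ)) ^ r := by
    rw [hFeq, integral_finsetSum _ fun m _ => integrable_finsetSum _ fun j _ =>
      (hterm (m + 1) j).const_mul _]
    simp only [Finset.mul_sum]
    refine Finset.sum_congr rfl fun m _ => ?_
    rw [integral_finsetSum _ fun j _ => (hterm (m + 1) j).const_mul _]
    refine Finset.sum_congr rfl fun j _ => ?_
    rw [integral_const_mul, integral_prod_mul (fun t : ℝ => t ^ (s - 1) * exp (-t) ^ (m + 1 + 1))
      (fun u : ℝ => u ^ (r - 1) * exp (-u) ^ (j + 1)),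
      integral_pow_mul_exp_neg_pow hs (Nat.succ_pos _),
      integral_pow_mul_exp_neg_pow hr (Nat.succ_pos _)]
    push_cast
    ring
  have hbound (N : ℕ) : ∀ᵐ p ∂(μ.prod μ), ‖F N p‖ ≤ B p := by
    filter_upwards [hpos] with p ⟨ht, hu⟩
    simp only [F, B]
    rw [norm_mul, norm_of_nonneg (by positivity), norm_eq_abs, mul_left_comm]
    gcongr
    exact (abs_sum_neg_geom_mul_sum_neg_geom_le (exp_pos _) (exp_lt_one_iff.2 (by linarith))
      (exp_pos _) (exp_lt_one_iff.2 (by linarith)) N).trans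
      (by gcongr; exact exp_neg_mul_exp_neg_div_le ht hu)
  have hlim : ∀ᵐ p ∂(μ.prod μ), Tendsto (fun N => F N p) atTop (𝓝 (-G p)) := by
    filter_upwards [hpos] with p ⟨ht, hu⟩
    convert (tendsto_sum_neg_geom_mul_sum_neg_geom (exp_pos (-p.1)) (exp_lt_one_iff.2 (by linarith))
      (exp_pos (-p.2)) (exp_lt_one_iff.2 (by linarith))).const_mul (p.1 ^ (s - 1) * p.2 ^ (r - 1)) using 2
    have h₁ : 1 < exp p.1 := one_lt_exp_iff.2 ht
    have h₂ : 1 < exp p.2 := one_lt_exp_iff.2 hu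
    have h₃ : exp p.1 * exp p.2 - 1 ≠ 0 := by nlinarith
    simp only [G, exp_add, exp_neg]
    have h₄ : 1 - (exp p.1)⁻¹ * (exp p.2)⁻¹ = (exp p.1 * exp p.2 - 1) / (exp p.1 * exp p.2) := by
      field_simp
    rw [h₄]
    field_simp
  have hFmeas (N : ℕ) : AEStronglyMeasurable (F N) (μ.prod μ) :=
    (by fun_prop : Continuous (F N)).aestronglyMeasurable
  have hG : Integrable G (μ.prod μ) := by
    refine hB.mono' (by fun_prop) ?_
    filter_upwards [hlim, ae_all_iff.2 hbound] with p hp hb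
    rw [← norm_neg]
    exact le_of_tendsto hp.norm (.of_forall hb)
  have key := tendsto_integral_of_dominated_convergence B hFmeas hB hbound hlim
  rw [integral_neg, integral_prod G hG] at key
  simp_rw [hFint] at key
  have hΓ : Gamma r * Gamma s ≠ 0 :=
    (mul_pos (Gamma_pos_of_pos (by positivity)) (Gamma_pos_of_pos (by positivity))).ne'
  convert key.const_mul (1 / (Gamma r * Gamma s)) using 2
  · field_simp
  · simp only [G]
    ring

theorem dzetaA3_integral (r s : ℕ) (hr : 1 ≤ r) (hs : 1 ≤ s) :
    dzetaA3 r s = -(1/(Real.Gamma r * Real.Gamma s)) *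
      ∫ t in Set.Ioi (0 : ℝ), ∫ u in Set.Ioi (0 : ℝ),
        t^(s-1) * u^(r-1) / ((Real.exp t + 1) * (Real.exp (t + u) - 1)) :=
  (tendsto_dzetaA3_partial_sums r s hr hs).limUnder_eq
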